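/- Let X and Y be metrizable topological spaces and E ⊆ X × Y. Then there exists a separately continuous function f : X × Y → ℝ with D(f) = E if and only if E is the union of a sequence of F_σ sets E_m such that every point of X × Y has a neighborhood U for which both projections of E_m ∩ U (onto X and onto Y) are meager. -/

import Mathlib

/-- An `F_σ` set is a countable union of closed sets. -/
def IsFsigma {X : Type*} [TopologicalSpace X] (s : Set X) : Prop :=
  ∃ F : ℕ → Set X, (∀ n, IsClosed (F n)) ∧ s = ⋃ n, F n

open Set Filter Topology

section Preliminaries

variable {X Y : Type*} [TopologicalSpace X] [TopologicalSpace Y]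

lemma IsClosed.isFsigma {s : Set X} (hs : IsClosed s) : IsFsigma s :=
  ⟨fun _ => s, fun _ => hs, (iUnion_const s).symm⟩

lemma IsFsigma.inter {s t : Set X} (hs : IsFsigma s) (ht : IsFsigma t) : IsFsigma (s ∩ t) := by
  obtain ⟨F, hF, rfl⟩ := hs
  obtain ⟨G, hG, rfl⟩ := ht
  refine ⟨fun n => F n.unpair.1 ∩ G n.unpair.2, fun n => (hF _).inter (hG _), ?_⟩
  rw [iUnion_unpair fun i j => F i ∩ G j, iUnion_inter]
  simp_rw [inter_iUnion]

lemma IsFsigma.preimage {s : Set Y} (hs : IsFsigma s) {f : X → Y} (hf : Continuous f) :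
    IsFsigma (f ⁻¹' s) := by
  obtain ⟨F, hF, rfl⟩ := hs
  exact ⟨fun n => f ⁻¹' F n, fun n => (hF n).preimage hf, preimage_iUnion⟩

lemma IsClosed.isNowhereDense_frontier {s : Set X} (hs : IsClosed s) :
    IsNowhereDense (frontier s) := by
  rw [isClosed_frontier.isNowhereDense_iff, interior_frontier hs]

lemma IsNowhereDense.union {s t : Set X} (hs : IsNowhereDense s) (ht : IsNowhereDense t) :
    IsNowhereDense (s ∪ t) := by
  rw [IsNowhereDense, closure_union,
    interior_union_isClosed_of_interior_empty isClosed_closure ht, hs]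

lemma Set.Finite.isNowhereDense_biUnion {ι : Type*} {I : Set ι} (hI : I.Finite) {f : ι → Set X}
    (hf : ∀ i ∈ I, IsNowhereDense (f i)) : IsNowhereDense (⋃ i ∈ I, f i) := by
  induction I, hI using Set.Finite.induction_on with
  | empty => simp
  | insert _ _ ih =>
    rw [biUnion_insert]
    exact (hf _ (mem_insert _ _)).union (ih fun i hi => hf i (mem_insert_of_mem _ hi))

lemma IsMeagre.exists_isClosed_isNowhereDense {s : Set X} (hs : IsMeagre s) :
    ∃ N : ℕ → Set X, (∀ i, IsClosed (N i)) ∧ (∀ i, IsNowhereDense (N i)) ∧ s ⊆ ⋃ i, N i := by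
  obtain ⟨S, hS, hc, hsS⟩ := isMeagre_iff_countable_union_isNowhereDense.1 hs
  obtain ⟨N, hN⟩ := (hc.insert ∅).exists_eq_range ⟨∅, mem_insert _ _⟩
  have hmem : ∀ i, N i ∈ insert ∅ S := fun i => hN ▸ mem_range_self i
  refine ⟨fun i => closure (N i), fun i => isClosed_closure, fun i => ?_, fun x hx => ?_⟩
  · rcases hmem i with h | h
    · simp [h]
    · exact (hS _ h).closure
  · obtain ⟨t, ht, hxt⟩ := hsS hx
    obtain ⟨i, rfl⟩ : t ∈ range N := hN ▸ mem_insert_of_mem _ ht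
    exact mem_iUnion.2 ⟨i, subset_closure hxt⟩

end Preliminaries

section Necessity

/-- A pseudometric space has a base that is a countable union of locally finite open families. -/
lemma exists_sigma_locallyFinite_basis (Y : Type*) [PseudoMetricSpace Y] :
    ∃ W : ℕ → Y → Set Y, (∀ k a, IsOpen (W k a)) ∧ (∀ k, LocallyFinite (W k)) ∧
      ∀ y, ∀ V ∈ 𝓝 y, ∃ k a, y ∈ W k a ∧ W k a ⊆ V := by
  have h : ∀ k : ℕ, ∃ v : Y → Set Y, (∀ a, IsOpen (v a)) ∧ ⋃ a, v a = univ ∧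
      LocallyFinite v ∧ ∀ a, v a ⊆ Metric.ball a (1 / (k + 1 : ℝ)) := fun k =>
    precise_refinement _ (fun a => Metric.isOpen_ball)
      (iUnion_eq_univ_iff.2 fun y => ⟨y, Metric.mem_ball_self (by positivity)⟩)
  choose W hWo hWc hWf hWs using h
  refine ⟨W, hWo, hWf, fun y V hV => ?_⟩
  obtain ⟨ε, hε, hεV⟩ := Metric.mem_nhds_iff.1 hV
  obtain ⟨k, hk⟩ := exists_nat_one_div_lt (half_pos hε)
  obtain ⟨a, ha⟩ := iUnion_eq_univ_iff.1 (hWc k) y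
  refine ⟨k, a, ha, fun z hz => hεV ?_⟩
  have h1 := Metric.mem_ball.1 (hWs k a ha)
  have h2 := Metric.mem_ball.1 (hWs k a hz)
  have := dist_triangle_right z y a
  exact Metric.mem_ball.2 (by linarith)

/-- The points near which a separately continuous function oscillates by more than `2 * ε` are
covered by countably many `F_σ` sets with locally meagre first projection. -/
lemma exists_isFsigma_cover_of_separately_continuous {X Y : Type*} [TopologicalSpace X]
    [PseudoMetricSpace Y] {f : X × Y → ℝ} (hfX : ∀ y, Continuous fun x => f (x, y))
    (hfY : ∀ x, Continuous fun y => f (x, y)) {ε : ℝ} (hε : 0 < ε) :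
    ∃ S : ℕ → Set (X × Y), (∀ k, IsFsigma (S k)) ∧
      (∀ k p, ∃ U ∈ 𝓝 p, IsMeagre (Prod.fst '' (S k ∩ U))) ∧
      ∀ p, (∃ k, p ∈ S k) ∨ ∃ U ∈ 𝓝 p, ∀ q ∈ U, |f q - f p| ≤ 2 * ε := by
  obtain ⟨W, hWo, hWf, hWb⟩ := exists_sigma_locallyFinite_basis Y
  set C : ℕ → Y → Set X := fun k a => {x | ∀ y ∈ W k a, ∀ z ∈ W k a, |f (x, y) - f (x, z)| ≤ ε}
    with hC
  have hCc : ∀ k a, IsClosed (C k a) := fun k a => by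
    simp only [hC, ofPred_forall]
    refine isClosed_iInter fun y => isClosed_iInter fun _ => isClosed_iInter fun z =>
      isClosed_iInter fun _ => isClosed_le ((hfX y).sub (hfX z)).abs continuous_const
  choose F hFc hFs hFu _ using fun k a => (hWo k a).exists_iUnion_isClosed
  refine ⟨fun k => ⋃ a, frontier (C k a) ×ˢ W k a, fun k => ?_, fun k p => ?_, fun p => ?_⟩
  · refine ⟨fun j => ⋃ a, frontier (C k a) ×ˢ F k a j, fun j => ?_, ?_⟩
    · refine LocallyFinite.isClosed_iUnion ?_ fun a => isClosed_frontier.prod (hFc k a j)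
      refine ((hWf k).preimage_continuous continuous_snd).subset fun a q hq => hFs k a j hq.2
    · rw [iUnion_comm]
      refine iUnion_congr fun a => ?_
      rw [← prod_iUnion, hFu]
  · obtain ⟨V, hV, hVf⟩ := hWf k p.2
    refine ⟨Prod.snd ⁻¹' V, continuous_snd.continuousAt hV, ?_⟩
    refine (isMeagre_biUnion hVf.countable fun a _ =>
      (hCc k a).isNowhereDense_frontier.isMeagre).mono ?_
    rintro _ ⟨q, ⟨hq, hqV⟩, rfl⟩
    obtain ⟨a, ha⟩ := mem_iUnion.1 hq
    exact mem_iUnion₂.2 ⟨a, ⟨q.2, ha.2, hqV⟩, ha.1⟩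
  · obtain ⟨x, y⟩ := p
    obtain ⟨k, a, hy, hWV⟩ := hWb y {z | dist (f (x, z)) (f (x, y)) < ε / 2}
      ((hfY x).continuousAt (Metric.ball_mem_nhds _ (half_pos hε)))
    have hx : x ∈ C k a := fun u hu v hv => by
      have h1 : dist (f (x, u)) (f (x, y)) < ε / 2 := hWV hu
      have h2 : dist (f (x, v)) (f (x, y)) < ε / 2 := hWV hv
      have := dist_triangle_right (f (x, u)) (f (x, v)) (f (x, y))
      rw [← Real.dist_eq]
      linarith
    by_cases hxi : x ∈ interior (C k a)
    · refine Or.inr ⟨({z | dist (f (z, y)) (f (x, y)) < ε} ∩ C k a) ×ˢ W k a,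
        prod_mem_nhds (inter_mem ((hfX y).continuousAt (Metric.ball_mem_nhds _ hε))
          (mem_interior_iff_mem_nhds.1 hxi)) ((hWo k a).mem_nhds hy), ?_⟩
      rintro ⟨u, v⟩ ⟨⟨hu, huC⟩, hv⟩
      have h1 : dist (f (u, y)) (f (x, y)) < ε := hu
      have h2 := huC v hv y hy
      rw [← Real.dist_eq] at h2 ⊢
      linarith [dist_triangle (f (u, v)) (f (u, y)) (f (x, y))]
    · exact Or.inl ⟨k, mem_iUnion.2 ⟨a, ⟨subset_closure hx, hxi⟩, hy⟩⟩

/-- The discontinuity set of a separately continuous function is a countable union of `F_σ` sets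
with locally meagre projections. -/
lemma exists_isFsigma_locally_meagre_of_separately_continuous {X Y : Type*}
    [PseudoMetricSpace X] [PseudoMetricSpace Y] {f : X × Y → ℝ}
    (hfX : ∀ y, Continuous fun x => f (x, y)) (hfY : ∀ x, Continuous fun y => f (x, y)) :
    ∃ Es : ℕ → Set (X × Y), (∀ m, IsFsigma (Es m) ∧ ∀ p : X × Y, ∃ U ∈ 𝓝 p,
      IsMeagre (Prod.fst '' (Es m ∩ U)) ∧ IsMeagre (Prod.snd '' (Es m ∩ U))) ∧
      {p | ¬ ContinuousAt f p} = ⋃ m, Es m := by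
  have hpos : ∀ n : ℕ, (0 : ℝ) < 1 / (n + 1) := fun n => by positivity
  set D : ℕ → Set (X × Y) := fun n =>
    (⋃₀ {U | IsOpen U ∧ ∀ a ∈ U, ∀ b ∈ U, |f a - f b| ≤ 1 / (n + 1 : ℝ)})ᶜ with hD
  have hDc : ∀ n, IsClosed (D n) := fun n =>
    (isOpen_sUnion fun U hU => hU.1).isClosed_compl
  have hDmem : ∀ (n : ℕ) p, (∃ U ∈ 𝓝 p, ∀ q ∈ U, |f q - f p| ≤ 2 * (1 / (n + 1) / 4 : ℝ)) →
      p ∉ D n := by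
    rintro n p ⟨U, hU, h⟩ hp
    refine hp ⟨interior U, ⟨isOpen_interior, fun a ha b hb => ?_⟩,
      mem_interior_iff_mem_nhds.2 hU⟩
    have h1 := h a (interior_subset ha)
    have h2 := h b (interior_subset hb)
    rw [← Real.dist_eq] at h1 h2 ⊢
    linarith [dist_triangle_right (f a) (f b) (f p)]
  choose S hSF hSm hSc using fun n : ℕ => exists_isFsigma_cover_of_separately_continuous
    hfX hfY (div_pos (hpos n) four_pos)
  choose T hTF hTm hTc using fun n : ℕ => exists_isFsigma_cover_of_separately_continuous
    (f := f ∘ Prod.swap) hfY hfX (div_pos (hpos n) four_pos)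
  set G : ℕ × ℕ × ℕ → Set (X × Y) := fun i =>
    D i.1 ∩ S i.1 i.2.1 ∩ Prod.swap ⁻¹' T i.1 i.2.2 with hG
  obtain ⟨e, he⟩ := exists_surjective_nat (ℕ × ℕ × ℕ)
  refine ⟨G ∘ e, fun m => ⟨?_, fun p => ?_⟩, ?_⟩
  · exact ((hDc _).isFsigma.inter (hSF _ _)).inter ((hTF _ _).preimage continuous_swap)
  · obtain ⟨U, hU, hUm⟩ := hSm (e m).1 (e m).2.1 p
    obtain ⟨V, hV, hVm⟩ := hTm (e m).1 (e m).2.2 p.swap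
    refine ⟨U ∩ Prod.swap ⁻¹' V, inter_mem hU (continuous_swap.continuousAt hV),
      hUm.mono ?_, hVm.mono ?_⟩
    · rintro _ ⟨q, hq, rfl⟩
      exact ⟨q, ⟨hq.1.1.2, hq.2.1⟩, rfl⟩
    · rintro _ ⟨q, hq, rfl⟩
      exact ⟨q.swap, ⟨hq.1.2, hq.2.2⟩, rfl⟩
  · rw [show ⋃ m, (G ∘ e) m = ⋃ i, G i from he.iUnion_comp G]
    ext p
    simp only [mem_ofPred_eq, mem_iUnion]
    refine ⟨fun hp => ?_, ?_⟩
    · obtain ⟨n, hn⟩ : ∃ n, p ∈ D n := by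
        by_contra! h
        refine hp (Metric.continuousAt_iff'.2 fun ε hε => ?_)
        obtain ⟨n, hn⟩ := exists_nat_one_div_lt hε
        obtain ⟨U, ⟨hUo, hU⟩, hpU⟩ := not_not.1 (h n)
        filter_upwards [hUo.mem_nhds hpU] with q hq
        exact (hU q hq p hpU).trans_lt hn
      obtain ⟨k, hk⟩ := (hSc n p).resolve_right fun h => hDmem n p h hn
      obtain ⟨l, hl⟩ := (hTc n p.swap).resolve_right fun ⟨U, hU, h⟩ => hDmem n p
        ⟨Prod.swap ⁻¹' U, continuous_swap.continuousAt hU, fun q hq => h q.swap hq⟩ hn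
      exact ⟨(n, k, l), ⟨hn, hk⟩, hl⟩
    · rintro ⟨⟨n, k, l⟩, ⟨hn, _⟩, _⟩ hp
      refine hDmem n p ⟨_, hp (Metric.ball_mem_nhds (f p)
        (mul_pos two_pos (div_pos (hpos n) four_pos))), fun q hq => ?_⟩ hn
      exact (Metric.mem_ball.1 hq).le

end Necessity

section Sufficiency

/-- Both coordinate projections of `s` are nowhere dense. -/
def HasNowhereDenseProjections {X Y : Type*} [TopologicalSpace X] [TopologicalSpace Y]
    (s : Set (X × Y)) : Prop :=
  IsNowhereDense (Prod.fst '' s) ∧ IsNowhereDense (Prod.snd '' s)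

lemma HasNowhereDenseProjections.mono {X Y : Type*} [TopologicalSpace X] [TopologicalSpace Y]
    {s t : Set (X × Y)} (h : s ⊆ t) (ht : HasNowhereDenseProjections t) :
    HasNowhereDenseProjections s :=
  ⟨ht.1.mono (image_mono h), ht.2.mono (image_mono h)⟩

/-- A closed set with locally meagre projections is a countable union of closed sets with locally
nowhere dense projections. -/
lemma exists_isClosed_locally_nowhereDense {X Y : Type*} [TopologicalSpace X] [TopologicalSpace Y]
    [ParacompactSpace (X × Y)] [NormalSpace (X × Y)] {F : Set (X × Y)} (hF : IsClosed F)
    (h : ∀ p, ∃ U ∈ 𝓝 p, IsMeagre (Prod.fst '' (F ∩ U)) ∧ IsMeagre (Prod.snd '' (F ∩ U))) :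
    ∃ K : ℕ × ℕ → Set (X × Y), (∀ i, IsClosed (K i)) ∧
      (∀ i p, ∃ U ∈ 𝓝 p, HasNowhereDenseProjections (K i ∩ U)) ∧ F = ⋃ i, K i := by
  choose U hU hUX hUY using h
  obtain ⟨v, hvo, hvc, hvf, hvU⟩ := precise_refinement (fun p => interior (U p))
    (fun _ => isOpen_interior)
    (iUnion_eq_univ_iff.2 fun p => ⟨p, mem_interior_iff_mem_nhds.2 (hU p)⟩)
  obtain ⟨C, hCc, hC, hCv⟩ := exists_iUnion_eq_closed_subset hvo hvf.point_finite hvc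
  choose N hNc hNn hN using fun p => (hUX p).exists_isClosed_isNowhereDense
  choose M hMc hMn hM using fun p => (hUY p).exists_isClosed_isNowhereDense
  refine ⟨fun i => ⋃ p, F ∩ C p ∩ N p i.1 ×ˢ M p i.2, fun i => ?_, fun i p => ?_, ?_⟩
  · refine (hvf.subset fun p q hq => hCv p hq.1.2).isClosed_iUnion fun p => ?_
    exact (hF.inter (hC p)).inter ((hNc _ _).prod (hMc _ _))
  · obtain ⟨V, hV, hVf⟩ := hvf p
    have key : ∀ q ∈ (⋃ p, F ∩ C p ∩ N p i.1 ×ˢ M p i.2) ∩ V,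
        ∃ p, (v p ∩ V).Nonempty ∧ q ∈ N p i.1 ×ˢ M p i.2 := by
      rintro q ⟨hq, hqV⟩
      obtain ⟨p, hp⟩ := mem_iUnion.1 hq
      exact ⟨p, ⟨q, hCv p hp.1.2, hqV⟩, hp.2⟩
    refine ⟨V, hV, (hVf.isNowhereDense_biUnion fun p _ => hNn p i.1).mono ?_,
      (hVf.isNowhereDense_biUnion fun p _ => hMn p i.2).mono ?_⟩
    · rintro _ ⟨q, hq, rfl⟩
      obtain ⟨p, hp, hqp⟩ := key q hq
      exact mem_iUnion₂.2 ⟨p, hp, hqp.1⟩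
    · rintro _ ⟨q, hq, rfl⟩
      obtain ⟨p, hp, hqp⟩ := key q hq
      exact mem_iUnion₂.2 ⟨p, hp, hqp.2⟩
  · refine Subset.antisymm (fun q hq => ?_) (iUnion_subset fun i => iUnion_subset fun p q hq =>
      hq.1.1)
    obtain ⟨p, hp⟩ := iUnion_eq_univ_iff.1 hCc q
    have hqU : q ∈ F ∩ U p := ⟨hq, interior_subset (hvU p (hCv p hp))⟩
    obtain ⟨i, hi⟩ := mem_iUnion.1 (hN p (mem_image_of_mem _ hqU))
    obtain ⟨j, hj⟩ := mem_iUnion.1 (hM p (mem_image_of_mem _ hqU))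
    exact mem_iUnion.2 ⟨(i, j), mem_iUnion.2 ⟨p, ⟨hq, hp⟩, hi, hj⟩⟩

/-- A closed set with locally nowhere dense projections is a countable union of closed sets whose
projections are nowhere dense at a uniform scale. -/
lemma exists_isClosed_uniformly_nowhereDense {X Y : Type*} [PseudoMetricSpace X]
    [PseudoMetricSpace Y] {K : Set (X × Y)} (hK : IsClosed K)
    (h : ∀ p, ∃ U ∈ 𝓝 p, HasNowhereDenseProjections (K ∩ U)) :
    ∃ L : ℕ → Set (X × Y), (∀ k, IsClosed (L k)) ∧
      (∀ k, ∃ r > 0, ∀ p ∈ L k, HasNowhereDenseProjections (L k ∩ Metric.ball p r)) ∧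
      K = ⋃ k, L k := by
  set G : ℕ → Set (X × Y) := fun k =>
    {p ∈ K | HasNowhereDenseProjections (K ∩ Metric.ball p (1 / (k + 1 : ℝ)))} with hG
  have hGK : ∀ k, closure (G k) ⊆ K := fun k => closure_minimal (fun p hp => hp.1) hK
  refine ⟨fun k => closure (G k), fun k => isClosed_closure, fun k => ?_,
    Subset.antisymm (fun p hp => ?_) (iUnion_subset hGK)⟩
  · have hk : (0 : ℝ) < 1 / (k + 1) := by positivity
    refine ⟨1 / (k + 1 : ℝ) / 2, half_pos hk, fun p hp => ?_⟩
    obtain ⟨q, hq, hpq⟩ := Metric.mem_closure_iff.1 hp _ (half_pos hk)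
    refine hq.2.mono (inter_subset_inter (hGK k) (Metric.ball_subset_ball' ?_))
    linarith
  · obtain ⟨U, hU, hUn⟩ := h p
    obtain ⟨ε, hε, hεU⟩ := Metric.mem_nhds_iff.1 hU
    obtain ⟨k, hk⟩ := exists_nat_one_div_lt hε
    exact mem_iUnion.2 ⟨k, subset_closure ⟨hp, hUn.mono
      (inter_subset_inter_right _ ((Metric.ball_subset_ball hk.le).trans hεU))⟩⟩

/-- A continuous function that takes values at least `1` within `δ` of each point of `E`, and whose
support is close to `E` but avoids the crosses through nearby points of `E`. -/
lemma exists_continuous_avoiding_crosses {X Y : Type*} [MetricSpace X] [MetricSpace Y]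
    {E : Set (X × Y)} {r : ℝ}
    (hr : ∀ p ∈ E, HasNowhereDenseProjections (E ∩ Metric.ball p r)) {δ : ℝ} (hδ : 0 < δ) :
    ∃ g : X × Y → ℝ, Continuous g ∧ (∀ q, 0 ≤ g q) ∧ (∀ p ∈ E, ∃ q, dist q p < δ ∧ 1 ≤ g q) ∧
      ∀ q, g q ≠ 0 → ∃ s ∈ E, dist q s < δ ∧
        q.1 ∉ Prod.fst '' (E ∩ Metric.ball s r) ∧ q.2 ∉ Prod.snd '' (E ∩ Metric.ball s r) := by
  obtain ⟨v, hvo, hvc, hvf, hvb⟩ := precise_refinement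
    (fun p : X × Y => Metric.ball p (δ / 2)) (fun _ => Metric.isOpen_ball)
    (iUnion_eq_univ_iff.2 fun p => ⟨p, Metric.mem_ball_self (half_pos hδ)⟩)
  have hdist : ∀ a, ∀ p ∈ v a, ∀ q ∈ v a, dist p q < δ := fun a p hp q hq => by
    have h1 := Metric.mem_ball.1 (hvb a hp)
    have h2 := Metric.mem_ball.1 (hvb a hq)
    linarith [dist_triangle_right p q a]
  have hbump : ∀ a, ∃ b : X × Y → ℝ, Continuous b ∧ (∀ q, 0 ≤ b q) ∧
      ((v a ∩ E).Nonempty → ∃ q ∈ v a, 1 ≤ b q) ∧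
      ∀ q, b q ≠ 0 → q ∈ v a ∧ ∃ s ∈ v a ∩ E, q.1 ∉ Prod.fst '' (E ∩ Metric.ball s r) ∧
        q.2 ∉ Prod.snd '' (E ∩ Metric.ball s r) := by
    intro a
    by_cases hne : (v a ∩ E).Nonempty
    · obtain ⟨s, hsv, hsE⟩ := hne
      obtain ⟨hX, hY⟩ := hr s hsE
      set O := v a ∩ (closure (Prod.fst '' (E ∩ Metric.ball s r)))ᶜ ×ˢ
        (closure (Prod.snd '' (E ∩ Metric.ball s r)))ᶜ with hO
      have hOo : IsOpen O := (hvo a).inter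
        (isClosed_closure.isOpen_compl.prod isClosed_closure.isOpen_compl)
      obtain ⟨d, hd⟩ : O.Nonempty :=
        ((interior_eq_empty_iff_dense_compl.1 hX).prod
          (interior_eq_empty_iff_dense_compl.1 hY)).inter_open_nonempty _ (hvo a) ⟨s, hsv⟩
      obtain ⟨b, hb0, hb1, hb⟩ := exists_continuous_zero_one_of_isClosed hOo.isClosed_compl
        (isClosed_singleton (x := d)) (disjoint_singleton_right.2 (not_not.2 hd))
      refine ⟨b, b.continuous, fun q => (hb q).1, fun _ => ⟨d, hd.1, (hb1 rfl).ge⟩,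
        fun q hq => ?_⟩
      have hqO : q ∈ O := by_contra fun h => hq (hb0 h)
      exact ⟨hqO.1, s, ⟨hsv, hsE⟩, fun h => hqO.2.1 (subset_closure h),
        fun h => hqO.2.2 (subset_closure h)⟩
    · exact ⟨fun _ => 0, continuous_const, fun _ => le_rfl, fun h => absurd h hne,
        fun q hq => absurd rfl hq⟩
  choose b hbc hb0 hb1 hbs using hbump
  have hbf : LocallyFinite fun a => Function.support (b a) :=
    hvf.subset fun a q hq => (hbs a q hq).1
  refine ⟨fun q => ∑ᶠ a, b a q, continuous_finsum hbc hbf, fun q => finsum_nonneg fun a => hb0 a q,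
    fun p hp => ?_, fun q hq => ?_⟩
  · obtain ⟨a, ha⟩ := iUnion_eq_univ_iff.1 hvc p
    obtain ⟨q, hqv, hq⟩ := hb1 a ⟨p, ha, hp⟩
    exact ⟨q, hdist a q hqv p ha, hq.trans
      (single_le_finsum a (hbf.point_finite q) fun j => hb0 j q)⟩
  · obtain ⟨a, ha⟩ : ∃ a, b a q ≠ 0 := by
      by_contra! h
      exact hq (finsum_eq_zero_of_forall_eq_zero h)
    obtain ⟨hqv, s, ⟨hsv, hsE⟩, hs⟩ := hbs a q ha
    exact ⟨s, hsE, hdist a q hqv s hsv, hs⟩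

lemma continuousAt_tsum_of_eventually_eq_zero {Z : Type*} [TopologicalSpace Z] {g : ℕ → Z → ℝ}
    (hg : ∀ n, Continuous (g n)) {z : Z} {N : ℕ} (h : ∀ᶠ w in 𝓝 z, ∀ n ≥ N, g n w = 0) :
    ContinuousAt (fun w => ∑' n, g n w) z := by
  have hs : ContinuousAt (fun w => ∑ n ∈ Finset.range N, g n w) z := by fun_prop
  refine hs.congr ?_
  filter_upwards [h] with w hw
  refine (tsum_eq_sum fun n hn => hw n ?_).symm
  simpa using hn

/-- A closed set whose projections are nowhere dense at a uniform scale is the discontinuity set of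
a separately continuous function vanishing on it and frequently equal to `1` near each of its
points. -/
lemma exists_separately_continuous_of_uniformly_nowhereDense {X Y : Type*} [MetricSpace X]
    [MetricSpace Y] {E : Set (X × Y)} (hE : IsClosed E) {r : ℝ} (hr0 : 0 < r)
    (hr : ∀ p ∈ E, HasNowhereDenseProjections (E ∩ Metric.ball p r)) :
    ∃ f : X × Y → ℝ, (∀ q, 0 ≤ f q) ∧ (∀ q, f q ≤ 1) ∧ (∀ y, Continuous fun x => f (x, y)) ∧
      (∀ x, Continuous fun y => f (x, y)) ∧ (∀ p ∉ E, ContinuousAt f p) ∧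
      ∀ p ∈ E, f p = 0 ∧ ∃ᶠ q in 𝓝 p, f q = 1 := by
  have hδ : ∀ n : ℕ, 0 < min (r / 2) (1 / (n + 1 : ℝ)) := fun n =>
    lt_min (half_pos hr0) (by positivity)
  choose g hgc hg0 hg1 hgs using fun n : ℕ => exists_continuous_avoiding_crosses hr (hδ n)
  have hoff : ∀ p ∉ E, ∃ N, ∀ᶠ q in 𝓝 p, ∀ n ≥ N, g n q = 0 := by
    intro p hp
    obtain ⟨η, hη, hηE⟩ := Metric.mem_nhds_iff.1 (hE.isOpen_compl.mem_nhds hp)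
    obtain ⟨N, hN⟩ := exists_nat_one_div_lt (half_pos hη)
    refine ⟨N, ?_⟩
    filter_upwards [Metric.ball_mem_nhds p (half_pos hη)] with q hq n hn
    by_contra hne
    obtain ⟨s, hs, hqs, _⟩ := hgs n q hne
    have h1 : (1 : ℝ) / (n + 1) ≤ 1 / (N + 1) := Nat.one_div_le_one_div hn
    have h2 := hqs.trans_le (min_le_right _ _)
    refine hηE (Metric.mem_ball.2 ?_) hs
    have h3 := Metric.mem_ball.1 hq
    linarith [dist_triangle_left s p q]
  have hX : ∀ p ∈ E, ∀ x, dist x p.1 < r / 2 → ∀ n, g n (x, p.2) = 0 := by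
    intro p hp x hx n
    by_contra hne
    obtain ⟨s, hs, hqs, _, h⟩ := hgs n _ hne
    refine h ⟨p, ⟨hp, Metric.mem_ball.2 ?_⟩, rfl⟩
    have h1 := hqs.trans_le (min_le_left _ _)
    have h2 : dist (x, p.2) p < r / 2 := by
      simpa [Prod.dist_eq, half_pos hr0] using hx
    linarith [dist_triangle_left p s (x, p.2)]
  have hY : ∀ p ∈ E, ∀ y, dist y p.2 < r / 2 → ∀ n, g n (p.1, y) = 0 := by
    intro p hp y hy n
    by_contra hne
    obtain ⟨s, hs, hqs, h, _⟩ := hgs n _ hne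
    refine h ⟨p, ⟨hp, Metric.mem_ball.2 ?_⟩, rfl⟩
    have h1 := hqs.trans_le (min_le_left _ _)
    have h2 : dist (p.1, y) p < r / 2 := by
      simpa [Prod.dist_eq, half_pos hr0] using hy
    linarith [dist_triangle_left p s (p.1, y)]
  have hzero : ∀ p ∈ E, ∀ n, g n p = 0 := fun p hp =>
    hX p hp p.1 (by simpa using half_pos hr0)
  have hcont : ∀ p ∉ E, ContinuousAt (fun q => ∑' n, g n q) p := fun p hp => by
    obtain ⟨N, hN⟩ := hoff p hp
    exact continuousAt_tsum_of_eventually_eq_zero hgc hN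
  refine ⟨fun q => min 1 (∑' n, g n q), fun q => le_min zero_le_one (tsum_nonneg fun n => hg0 n q),
    fun q => min_le_left _ _, fun y => ?_, fun x => ?_,
    fun p hp => continuousAt_const.min (hcont p hp), fun p hp => ⟨by simp [hzero p hp], ?_⟩⟩
  · refine continuous_const.min (continuous_iff_continuousAt.2 fun x => ?_)
    by_cases hp : (x, y) ∈ E
    · refine continuousAt_tsum_of_eventually_eq_zero (g := fun n x => g n (x, y)) (N := 0)
        (fun n => (hgc n).comp (by fun_prop)) ?_
      filter_upwards [Metric.ball_mem_nhds x (half_pos hr0)] with u hu n _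
      exact hX _ hp u hu n
    · exact (hcont _ hp).comp (f := fun x => (x, y)) (by fun_prop)
  · refine continuous_const.min (continuous_iff_continuousAt.2 fun y => ?_)
    by_cases hp : (x, y) ∈ E
    · refine continuousAt_tsum_of_eventually_eq_zero (g := fun n y => g n (x, y)) (N := 0)
        (fun n => (hgc n).comp (by fun_prop)) ?_
      filter_upwards [Metric.ball_mem_nhds y (half_pos hr0)] with u hu n _
      exact hY _ hp u hu n
    · exact (hcont _ hp).comp (f := fun y => (x, y)) (by fun_prop)
  · refine Metric.nhds_basis_ball.frequently_iff.2 fun ε hε => ?_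
    obtain ⟨n, hn⟩ := exists_nat_one_div_lt hε
    obtain ⟨q, hqp, hq⟩ := hg1 n p hp
    refine ⟨q, Metric.mem_ball.2 ((hqp.trans_le (min_le_right _ _)).trans hn), min_eq_left ?_⟩
    have hqE : q ∉ E := fun h => by linarith [hzero q h n]
    obtain ⟨N, hN⟩ := hoff q hqE
    have hsum : Summable fun n => g n q := summable_of_ne_finset_zero (s := Finset.range N)
      fun n hn => hN.self_of_nhds n (by simpa using hn)
    exact hq.trans (hsum.le_tsum n fun j _ => hg0 j q)

/-- Weighted sums of separately continuous functions realize countable unions of discontinuity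
sets. -/
lemma exists_separately_continuous_iUnion {X Y : Type*} [TopologicalSpace X] [TopologicalSpace Y]
    {L : ℕ → Set (X × Y)}
    (h : ∀ n, ∃ f : X × Y → ℝ, (∀ q, 0 ≤ f q) ∧ (∀ q, f q ≤ 1) ∧
      (∀ y, Continuous fun x => f (x, y)) ∧ (∀ x, Continuous fun y => f (x, y)) ∧
      (∀ p ∉ L n, ContinuousAt f p) ∧ ∀ p ∈ L n, f p = 0 ∧ ∃ᶠ q in 𝓝 p, f q = 1) :
    ∃ f : X × Y → ℝ, (∀ y, Continuous fun x => f (x, y)) ∧ (∀ x, Continuous fun y => f (x, y)) ∧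
      {p | ¬ ContinuousAt f p} = ⋃ n, L n := by
  choose f hf0 hf1 hfX hfY hfc hfL using h
  set u : ℕ → ℝ := fun n => (1 / 4 : ℝ) ^ n with hu
  have hu0 : ∀ n, 0 < u n := fun n => by positivity
  have hus : Summable u := summable_geometric_of_lt_one (by norm_num) (by norm_num)
  have hle : ∀ n q, u n * f n q ≤ u n := fun n q =>
    mul_le_of_le_one_right (hu0 n).le (hf1 n q)
  have hnn : ∀ n q, 0 ≤ u n * f n q := fun n q => mul_nonneg (hu0 n).le (hf0 n q)
  have hbd : ∀ n q, ‖u n * f n q‖ ≤ u n := fun n q => by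
    rw [Real.norm_of_nonneg (hnn n q)]
    exact hle n q
  have hsum : ∀ q, Summable fun n => u n * f n q := fun q =>
    Summable.of_nonneg_of_le (hnn · q) (hle · q) hus
  refine ⟨fun q => ∑' n, u n * f n q, fun y => ?_, fun x => ?_, ?_⟩
  · exact continuous_tsum (fun n => continuous_const.mul (hfX n y)) hus fun n x => hbd n _
  · exact continuous_tsum (fun n => continuous_const.mul (hfY n x)) hus fun n y => hbd n _
  · ext p
    simp only [mem_ofPred_eq, mem_iUnion]
    refine ⟨fun hp => ?_, fun hp hcont => ?_⟩
    · by_contra! hL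
      exact hp (tendsto_tsum_of_dominated_convergence hus
        (fun n => continuousAt_const.mul (hfc n p (hL n))) (Eventually.of_forall fun q n => hbd n q))
    · classical
      set n := Nat.find hp with hn
      have hpn : p ∈ L n := Nat.find_spec hp
      have hhead : ContinuousAt (fun q => ∑ k ∈ Finset.range n, u k * f k q) p := by
        refine tendsto_finsetSum _ fun k hk => ?_
        exact continuousAt_const.mul (hfc k p (Nat.find_min hp (Finset.mem_range.1 hk)))
      have hsplit : ∀ q, ∑' k, u k * f k q = (∑ k ∈ Finset.range n, u k * f k q) +
          (u n * f n q + ∑' k, u (k + (n + 1)) * f (k + (n + 1)) q) := fun q => by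
        rw [← (hsum q).sum_add_tsum_nat_add (n + 1), Finset.sum_range_succ, add_assoc]
      have htail0 : ∀ q, 0 ≤ ∑' k, u (k + (n + 1)) * f (k + (n + 1)) q := fun q =>
        tsum_nonneg fun k => hnn _ q
      have htail : ∀ q, ∑' k, u (k + (n + 1)) * f (k + (n + 1)) q ≤ u n / 3 := fun q => by
        refine (((summable_nat_add_iff (n + 1)).2 (hsum q)).tsum_le_tsum (fun k => hle _ q)
          ((summable_nat_add_iff (n + 1)).2 hus)).trans_eq ?_
        simp only [hu, pow_add, tsum_mul_right]
        rw [tsum_geometric_of_lt_one (by norm_num) (by norm_num)]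
        ring
      have hε : 0 < u n / 4 := div_pos (hu0 n) four_pos
      obtain ⟨q, hq1, hq2, hq3⟩ := ((hfL n p hpn).2.and_eventually
        ((Metric.tendsto_nhds.1 hcont _ hε).and (Metric.tendsto_nhds.1 hhead _ hε))).exists
      rw [Real.dist_eq, abs_lt] at hq2 hq3
      have h1 := htail p
      have h2 := htail0 q
      have h3 := hq2.2
      have h4 := hq3.1
      beta_reduce at h3 h4
      rw [hsplit q, hsplit p, hq1, (hfL n p hpn).1] at h3
      linarith [hu0 n]

end Sufficiency

theorem discontinuity_set_characterization_two_factors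
    {X Y : Type*} [TopologicalSpace X] [TopologicalSpace Y]
    [TopologicalSpace.MetrizableSpace X] [TopologicalSpace.MetrizableSpace Y]
    (E : Set (X × Y)) :
    (∃ f : X × Y → ℝ,
        (∀ y : Y, Continuous fun x => f (x, y)) ∧
        (∀ x : X, Continuous fun y => f (x, y)) ∧
        {p | ¬ ContinuousAt f p} = E) ↔
    (∃ Es : ℕ → Set (X × Y),
      (∀ m, IsFsigma (Es m) ∧
        ∀ p : X × Y, ∃ U ∈ nhds p,
          IsMeagre (Prod.fst '' (Es m ∩ U)) ∧ IsMeagre (Prod.snd '' (Es m ∩ U))) ∧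
      E = ⋃ m, Es m) := by
  let := TopologicalSpace.metrizableSpaceMetric X
  let := TopologicalSpace.metrizableSpaceMetric Y
  constructor
  · rintro ⟨f, hfX, hfY, rfl⟩
    exact exists_isFsigma_locally_meagre_of_separately_continuous hfX hfY
  · rintro ⟨Es, hEs, rfl⟩
    choose F hFc hF using fun m => (hEs m).1
    have hFE : ∀ m j, F m j ⊆ Es m := fun m j => hF m ▸ subset_iUnion (F m) j
    choose K hKc hKn hK using fun m j => exists_isClosed_locally_nowhereDense (hFc m j) fun p =>
      let ⟨U, hU, hX, hY⟩ := (hEs m).2 p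
      ⟨U, hU, hX.mono (image_mono (inter_subset_inter_left _ (hFE m j))),
        hY.mono (image_mono (inter_subset_inter_left _ (hFE m j)))⟩
    choose L hLc hLn hL using fun m j i =>
      exists_isClosed_uniformly_nowhereDense (hKc m j i) (hKn m j i)
    obtain ⟨e, he⟩ := exists_surjective_nat (ℕ × ℕ × (ℕ × ℕ) × ℕ)
    set G : ℕ × ℕ × (ℕ × ℕ) × ℕ → Set (X × Y) := fun t => L t.1 t.2.1 t.2.2.1 t.2.2.2 with hG
    have hEG : ⋃ m, Es m = ⋃ n, G (e n) := by
      rw [he.iUnion_comp G]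
      simp_rw [hF, hK, hL, hG, iUnion_prod']
    rw [hEG]
    refine exists_separately_continuous_iUnion fun n => ?_
    obtain ⟨r, hr0, hr⟩ := hLn (e n).1 (e n).2.1 (e n).2.2.1 (e n).2.2.2
    exact exists_separately_continuous_of_uniformly_nowhereDense (hLc _ _ _ _) hr0 hr
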